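/- Let Q be the 3-dimensional real Leibniz algebra with bracket determined by [f,f]=e and [g,g]=−e (all other brackets of basis vectors zero). A linear map N : Q → Q is a Nijenhuis operator on Q if and only if its matrix (rows = coordinates of N(e), N(f), N(g) in the basis {e,f,g}) has one of the following forms for real parameters: (1) rows (k₁,0,0), (ℓ₁,ℓ₂,ℓ₂−k₁), (p₁,p₃−k₁,p₃); (2) rows (k₁,0,0), (ℓ₁,k₁,0), (p₁,k₁−p₃,p₃) with p₃≠k₁; (3) rows (k₁,0,0), (ℓ₁,ℓ₂,k₁−ℓ₂), (p₁,k₁−p₃,p₃) with ℓ₂≠k₁. -/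

import Mathlib

/-- Bracket of the 3-dim real Leibniz algebra with [f,f]=e, [g,g]=-e
(basis e,f,g ↔ indices 0,1,2). -/
noncomputable def br (x y : Fin 3 → ℝ) : Fin 3 → ℝ :=
  ![x 1 * y 1 - x 2 * y 2, 0, 0]

/-- A linear map on `ℝ³` fixing the line of `e` satisfies the Nijenhuis identity for `br` as soon as
its rows, shifted by the eigenvalue `k` of `e`, span an isotropic subspace of the plane `⟨f, g⟩`. -/
theorem br_nijenhuis_of_isotropic {N : (Fin 3 → ℝ) →ₗ[ℝ] (Fin 3 → ℝ)}
    {k l₁ l₂ l₃ p₁ p₂ p₃ : ℝ}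
    (he : N ![1, 0, 0] = ![k, 0, 0]) (hf : N ![0, 1, 0] = ![l₁, l₂, l₃])
    (hg : N ![0, 0, 1] = ![p₁, p₂, p₃])
    (hff : (l₂ - k) ^ 2 = l₃ ^ 2) (hfg : (l₂ - k) * p₂ = l₃ * (p₃ - k))
    (hgg : p₂ ^ 2 = (p₃ - k) ^ 2) (x y : Fin 3 → ℝ) :
    br (N x) (N y) + N (N (br x y)) = N (br (N x) y) + N (br x (N y)) := by
  have hN (z : Fin 3 → ℝ) : N z = ![z 0 * k + z 1 * l₁ + z 2 * p₁,
      z 1 * l₂ + z 2 * p₂, z 1 * l₃ + z 2 * p₃] := by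
    have hz : z = z 0 • ![1, 0, 0] + z 1 • ![0, 1, 0] + z 2 • ![0, 0, 1] := by
      ext i; fin_cases i <;> simp
    conv_lhs => rw [hz]
    simp only [map_add, map_smul, he, hf, hg]
    ext i; fin_cases i <;> simp
  ext i
  fin_cases i
  · simp [hN, br]
    linear_combination x 1 * y 1 * hff + (x 1 * y 2 + x 2 * y 1) * hfg + x 2 * y 2 * hgg
  all_goals simp [hN, br]

/-- The coefficient equations extracted from the Nijenhuis identity on basis vectors. -/
theorem isotropic_of_br_nijenhuis {N : (Fin 3 → ℝ) →ₗ[ℝ] (Fin 3 → ℝ)}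
    (h : ∀ x y, br (N x) (N y) + N (N (br x y)) = N (br (N x) y) + N (br x (N y)))
    {k k₂ k₃ l₁ l₂ l₃ p₁ p₂ p₃ : ℝ}
    (he : N ![1, 0, 0] = ![k, k₂, k₃]) (hf : N ![0, 1, 0] = ![l₁, l₂, l₃])
    (hg : N ![0, 0, 1] = ![p₁, p₂, p₃]) :
    k₂ = 0 ∧ k₃ = 0 ∧ (l₂ - k) ^ 2 = l₃ ^ 2 ∧ (l₂ - k) * p₂ = l₃ * (p₃ - k) ∧
      p₂ ^ 2 = (p₃ - k) ^ 2 := by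
  have hN (a : ℝ) : N ![a, 0, 0] = ![a * k, a * k₂, a * k₃] := by
    have ha : (![a, 0, 0] : Fin 3 → ℝ) = a • ![1, 0, 0] := by simp
    rw [ha, map_smul, he]; simp
  have hef := congrFun (h ![1, 0, 0] ![0, 1, 0]) 1
  have heg := congrFun (h ![1, 0, 0] ![0, 0, 1]) 2
  simp [br, he, hf, hg, hN] at hef heg
  obtain rfl : k₂ = 0 := by simpa using hef
  obtain rfl : k₃ = 0 := by simpa using heg
  have hff := congrFun (h ![0, 1, 0] ![0, 1, 0]) 0
  have hfg := congrFun (h ![0, 1, 0] ![0, 0, 1]) 0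
  have hgg := congrFun (h ![0, 0, 1] ![0, 0, 1]) 0
  simp [br, hf, hg, hN] at hff hfg hgg
  refine ⟨rfl, rfl, ?_, ?_, ?_⟩
  · linear_combination hff
  · linear_combination hfg
  · linear_combination hgg

theorem nijenhuis_classification_thm2_6 (N : (Fin 3 → ℝ) →ₗ[ℝ] (Fin 3 → ℝ)) :
    (∀ x y, br (N x) (N y) + N (N (br x y)) = N (br (N x) y) + N (br x (N y)))
    ↔
    ((∃ k₁ ℓ₁ ℓ₂ p₁ p₃ : ℝ,
        N ![1,0,0] = ![k₁,0,0] ∧ N ![0,1,0] = ![ℓ₁,ℓ₂,ℓ₂-k₁] ∧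
        N ![0,0,1] = ![p₁,p₃-k₁,p₃]) ∨
     (∃ k₁ ℓ₁ p₁ p₃ : ℝ, p₃ ≠ k₁ ∧
        N ![1,0,0] = ![k₁,0,0] ∧ N ![0,1,0] = ![ℓ₁,k₁,0] ∧
        N ![0,0,1] = ![p₁,k₁-p₃,p₃]) ∨
     (∃ k₁ ℓ₁ ℓ₂ p₁ p₃ : ℝ, ℓ₂ ≠ k₁ ∧
        N ![1,0,0] = ![k₁,0,0] ∧ N ![0,1,0] = ![ℓ₁,ℓ₂,k₁-ℓ₂] ∧
        N ![0,0,1] = ![p₁,k₁-p₃,p₃])) := by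
  constructor
  · intro h
    have hvec (v : Fin 3 → ℝ) : v = ![v 0, v 1, v 2] := by ext i; fin_cases i <;> rfl
    have he := hvec (N ![1, 0, 0])
    have hf := hvec (N ![0, 1, 0])
    have hg := hvec (N ![0, 0, 1])
    generalize N ![1, 0, 0] 0 = k, N ![1, 0, 0] 1 = k₂, N ![1, 0, 0] 2 = k₃ at he
    generalize N ![0, 1, 0] 0 = l₁, N ![0, 1, 0] 1 = l₂, N ![0, 1, 0] 2 = l₃ at hf
    generalize N ![0, 0, 1] 0 = p₁, N ![0, 0, 1] 1 = p₂, N ![0, 0, 1] 2 = p₃ at hg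
    obtain ⟨rfl, rfl, hff, hfg, hgg⟩ := isotropic_of_br_nijenhuis h he hf hg
    by_cases hl : l₂ = k
    · subst hl
      obtain rfl : l₃ = 0 := by simpa using hff.symm
      rcases sq_eq_sq_iff_eq_or_eq_neg.mp hgg with rfl | rfl
      · exact Or.inl ⟨_, _, l₂, _, _, he, by simpa using hf, hg⟩
      · by_cases hp : p₃ = l₂
        · subst hp
          exact Or.inl ⟨_, _, p₃, _, p₃, he, by simpa using hf, by simpa using hg⟩
        · exact Or.inr (Or.inl ⟨_, _, _, _, hp, he, hf, by simpa using hg⟩)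
    · have hl' : l₂ - k ≠ 0 := sub_ne_zero.mpr hl
      rcases sq_eq_sq_iff_eq_or_eq_neg.mp hff.symm with rfl | rfl
      · obtain rfl : p₂ = p₃ - k := mul_left_cancel₀ hl' hfg
        exact Or.inl ⟨_, _, _, _, _, he, hf, hg⟩
      · obtain rfl : p₂ = k - p₃ := mul_left_cancel₀ hl' (by linear_combination hfg)
        exact Or.inr (Or.inr ⟨_, _, _, _, _, hl, he, by simpa using hf, hg⟩)
  · rintro (⟨_, _, _, _, _, he, hf, hg⟩ | ⟨_, _, _, _, _, he, hf, hg⟩ |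
      ⟨_, _, _, _, _, _, he, hf, hg⟩) <;>
    exact br_nijenhuis_of_isotropic he hf hg (by ring) (by ring) (by ring)
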